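/- Let 0 < γ < 2 with γ ≠ 1. There exists a real number a > 0 and a solution R: V → ℝ of the radii system with initial values R(0) = 1 and R(i) = a·tan(γπ/4) such that R(z) > 0 and (γ−1)·(R(z)² − R(z−i)·R(z+1)) ≥ 0 for every z ∈ V_int. -/

import Mathlib

open Real
/-- Membership of `z = N + i M` in the quadrant `V = {N + iM : M ≥ |N|}`. -/
def inV (N M : ℤ) : Prop := |N| ≤ M

/-- Membership of `z = N + i M` in the interior part `V_int = {N + iM : M > |N|}`. -/
def inVint (N M : ℤ) : Prop := |N| < M

/-- Equation (square) at `z = N + i M`  (here `z + 1` shifts `N`, `z + i` shifts `M`). -/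
def SquareEq (γ : ℝ) (R : ℤ → ℤ → ℝ) (N M : ℤ) : Prop :=
  R N M * R (N + 1) M * (-2 * (M : ℝ) - γ) +
    R (N + 1) M * R (N + 1) (M + 1) * (2 * ((N : ℝ) + 1) - γ) +
    R (N + 1) (M + 1) * R N (M + 1) * (2 * ((M : ℝ) + 1) - γ) +
    R N (M + 1) * R N M * (-2 * (N : ℝ) - γ) = 0

/-- Equation (Ri) at `z = N + i M`. -/
def RiEq (R : ℤ → ℤ → ℝ) (N M : ℤ) : Prop :=
  ((N : ℝ) + M) * (R N M ^ 2 - R (N + 1) M * R N (M - 1)) * (R N (M + 1) + R (N + 1) M) +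
    ((M : ℝ) - N) * (R N M ^ 2 - R N (M + 1) * R (N + 1) M) * (R (N + 1) M + R N (M - 1)) = 0

/-- `R : V → ℝ` is a solution of the radii system: (square) holds whenever all four
corners lie in `V`, (recR) holds on both diagonals, and (Ri) holds on `V_int`. -/
def IsRadiiSolution (γ : ℝ) (R : ℤ → ℤ → ℝ) : Prop :=
  (∀ N M : ℤ, inV N M → inV (N + 1) M → inV N (M + 1) → inV (N + 1) (M + 1) →
      SquareEq γ R N M) ∧
  (∀ N : ℕ, R ((N : ℤ) + 1) ((N : ℤ) + 1) =
        ((2 * (N : ℝ) + γ) / (2 * ((N : ℝ) + 1) - γ)) * R (N : ℤ) (N : ℤ) ∧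
      R (-((N : ℤ) + 1)) ((N : ℤ) + 1) =
        ((2 * (N : ℝ) + γ) / (2 * ((N : ℝ) + 1) - γ)) * R (-(N : ℤ)) (N : ℤ)) ∧
  (∀ N M : ℤ, inVint N M → RiEq R N M)

noncomputable def ffA (e X Y : ℝ) : ℝ := ((2*Y+e)*X^2 - e*Y^2)/(2*Y*e+Y^2-X^2)
noncomputable def hhA (γ m X Y f : ℝ) : ℝ := X*(Y*(2*m+γ)+γ*f)/((2-γ)*Y+(2*m+2-γ)*f)
noncomputable def stA (γ b : ℝ) : ℕ → ℝ × ℝ × ℝ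
  | 0 => (1, b, γ/(2-γ))
  | n+1 => ((stA γ b n).2.1, ffA (stA γ b n).1 (stA γ b n).2.1 (stA γ b n).2.2,
      hhA γ ((n:ℝ)+1) (stA γ b n).2.1 (stA γ b n).2.2
        (ffA (stA γ b n).1 (stA γ b n).2.1 (stA γ b n).2.2))
noncomputable def eA (γ : ℝ) (n : ℕ) (b : ℝ) : ℝ := (stA γ b n).1
noncomputable def xA (γ : ℝ) (n : ℕ) (b : ℝ) : ℝ := (stA γ b n).2.1
noncomputable def yA (γ : ℝ) (n : ℕ) (b : ℝ) : ℝ := (stA γ b n).2.2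
noncomputable def wA (γ : ℝ) (n : ℕ) (b : ℝ) : ℝ :=
  (2*yA γ n b+eA γ n b)*xA γ n b^2 - eA γ n b*yA γ n b^2
noncomputable def dA (γ : ℝ) (n : ℕ) (b : ℝ) : ℝ :=
  2*yA γ n b*eA γ n b+yA γ n b^2-xA γ n b^2

lemma eA_succ (γ n b) : eA γ (n+1) b = xA γ n b := rfl
lemma xA_succ (γ n b) : xA γ (n+1) b = wA γ n b / dA γ n b := rfl
lemma yA_succ (γ : ℝ) (n : ℕ) (b : ℝ) : yA γ (n+1) b = xA γ n b*(yA γ n b*(2*((n:ℝ)+1)+γ)+γ*xA γ (n+1) b)/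
  ((2-γ)*yA γ n b+(2*((n:ℝ)+1)+2-γ)*xA γ (n+1) b) := rfl

def GA (γ : ℝ) : ℕ → ℝ → Prop
  | 0, b => 0 < b
  | n+1, b => GA γ n b ∧ 0 < wA γ n b ∧ 0 < dA γ n b
def HA (γ : ℝ) : ℕ → ℝ → Prop
  | 0, _ => True
  | n+1, b => HA γ n b ∧ xA γ n b^2 < eA γ n b * yA γ n b

lemma GA_mono {γ b : ℝ} {m n : ℕ} (h : m ≤ n) (hG : GA γ n b) : GA γ m b := by
  induction n, h using Nat.le_induction with
  | base => exact hG
  | succ k _ ih => exact ih hG.1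
lemma HA_mono {γ b : ℝ} {m n : ℕ} (h : m ≤ n) (hG : HA γ n b) : HA γ m b := by
  induction n, h using Nat.le_induction with
  | base => exact hG
  | succ k _ ih => exact ih hG.1

lemma hden {γ x y : ℝ} (n : ℕ) (h2 : γ < 2) (hx : 0 ≤ x) (hy : 0 < y) :
    0 < (2-γ)*y+(2*((n:ℝ)+1)+2-γ)*x := by
  have hn : (0:ℝ) ≤ n := n.cast_nonneg
  have h1 : 0 < (2-γ)*y := by apply mul_pos <;> linarith
  have h3 : 0 ≤ (2*((n:ℝ)+1)+2-γ)*x := by apply mul_nonneg <;> linarith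
  linarith

lemma posA {γ b : ℝ} (h0 : 0 < γ) (h2 : γ < 2) (n : ℕ) (hG : GA γ n b) :
    0 < eA γ n b ∧ 0 < xA γ n b ∧ 0 < yA γ n b := by
  induction n with
  | zero => exact ⟨one_pos, hG, div_pos h0 (by linarith)⟩
  | succ n ih =>
    obtain ⟨he, hx, hy⟩ := ih hG.1
    have hf : 0 < xA γ (n+1) b := by rw [xA_succ]; exact div_pos hG.2.1 hG.2.2
    refine ⟨hx, hf, ?_⟩
    rw [yA_succ]
    exact div_pos (by positivity) (hden n h2 hf.le hy)

lemma contA {γ b : ℝ} (h0 : 0 < γ) (h2 : γ < 2) (n : ℕ) (hG : GA γ n b) :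
    ContinuousAt (eA γ n) b ∧ ContinuousAt (xA γ n) b ∧ ContinuousAt (yA γ n) b := by
  induction n with
  | zero => exact ⟨continuousAt_const, continuousAt_id, continuousAt_const⟩
  | succ n ih =>
    obtain ⟨he, hx, hy⟩ := ih hG.1
    obtain ⟨pe, px, py⟩ := posA h0 h2 n hG.1
    obtain ⟨_, pf, _⟩ := posA h0 h2 (n+1) hG
    have hf : ContinuousAt (xA γ (n+1)) b := by
      have : ContinuousAt (fun b => wA γ n b / dA γ n b) b := by
        have c1 : ContinuousAt (wA γ n) b := by unfold wA; fun_prop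
        have c2 : ContinuousAt (dA γ n) b := by unfold dA; fun_prop
        exact ContinuousAt.div c1 c2 hG.2.2.ne'
      exact this
    refine ⟨hx, hf, ?_⟩
    have : ContinuousAt (fun b => xA γ n b*(yA γ n b*(2*((n:ℝ)+1)+γ)+γ*xA γ (n+1) b)/
      ((2-γ)*yA γ n b+(2*((n:ℝ)+1)+2-γ)*xA γ (n+1) b)) b := by
      refine ContinuousAt.div (by fun_prop) (by fun_prop) ?_
      exact (hden n h2 pf.le py).ne'
    exact this

open Filter Topology in
lemma GA_open {γ b : ℝ} (h0 : 0 < γ) (h2 : γ < 2) (n : ℕ) (hG : GA γ n b) :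
    ∀ᶠ c in 𝓝 b, GA γ n c := by
  induction n with
  | zero => exact lt_mem_nhds hG
  | succ n ih =>
    obtain ⟨he, hx, hy⟩ := contA h0 h2 n hG.1
    have c1 : ContinuousAt (wA γ n) b := by unfold wA; fun_prop
    have c2 : ContinuousAt (dA γ n) b := by unfold dA; fun_prop
    filter_upwards [ih hG.1, c1.eventually (lt_mem_nhds hG.2.1), c2.eventually (lt_mem_nhds hG.2.2)]
      with c a1 a2 a3 using ⟨a1, a2, a3⟩

open Filter Topology in
lemma HA_open {γ b : ℝ} (h0 : 0 < γ) (h2 : γ < 2) (n m : ℕ) (hm : m ≤ n+1) (hG : GA γ n b) (hH : HA γ m b) :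
    ∀ᶠ c in 𝓝 b, HA γ m c := by
  induction m with
  | zero => exact Eventually.of_forall fun _ => trivial
  | succ m ih =>
    obtain ⟨he, hx, hy⟩ := contA h0 h2 m (GA_mono (by omega) hG)
    have c1 : ContinuousAt (fun c => xA γ m c^2) b := by fun_prop
    have c2 : ContinuousAt (fun c => eA γ m c * yA γ m c) b := by fun_prop
    filter_upwards [ih (by omega) hH.1, c1.eventually_lt c2 hH.2]
      with c a1 a2 using ⟨a1, a2⟩

noncomputable def vA (γ : ℝ) (n : ℕ) (b : ℝ) : ℝ :=
  (2*yA γ (n+1) b+xA γ n b)*xA γ (n+1) b^2 - xA γ n b*yA γ (n+1) b^2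
lemma vA_eq (γ n b) : vA γ n b = wA γ (n+1) b := rfl

def PA (γ : ℝ) (n : ℕ) (b : ℝ) : Prop :=
  GA γ n b ∧ HA γ (n+1) b ∧ (wA γ n b < 0 ∨ wA γ (n+1) b < 0)
def QA (γ : ℝ) (n : ℕ) (b : ℝ) : Prop :=
  GA γ n b ∧ eA γ n b * yA γ n b < xA γ n b^2

lemma dA_pos {γ b : ℝ} (h0 : 0 < γ) (h2 : γ < 2) (n : ℕ) (hG : GA γ n b)
    (h : xA γ n b^2 ≤ eA γ n b * yA γ n b) : 0 < dA γ n b := by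
  obtain ⟨pe, px, py⟩ := posA h0 h2 n hG
  unfold dA; nlinarith [mul_pos pe py, mul_pos py py]

open Filter Topology in
lemma QA_open {γ b : ℝ} (h0 : 0 < γ) (h2 : γ < 2) (n : ℕ) (hQ : QA γ n b) :
    ∀ᶠ c in 𝓝 b, QA γ n c := by
  obtain ⟨he, hx, hy⟩ := contA h0 h2 n hQ.1
  have c1 : ContinuousAt (fun c => xA γ n c^2) b := by fun_prop
  have c2 : ContinuousAt (fun c => eA γ n c * yA γ n c) b := by fun_prop
  filter_upwards [GA_open h0 h2 n hQ.1, c2.eventually_lt c1 hQ.2]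
      with c a1 a2 using ⟨a1, a2⟩

open Filter Topology in
lemma PA_open {γ b : ℝ} (h0 : 0 < γ) (h2 : γ < 2) (n : ℕ) (hP : PA γ n b) :
    ∀ᶠ c in 𝓝 b, PA γ n c := by
  obtain ⟨hG, hH, hw⟩ := hP
  obtain ⟨he, hx, hy⟩ := contA h0 h2 n hG
  obtain ⟨pe, px, py⟩ := posA h0 h2 n hG
  have hd := dA_pos h0 h2 n hG hH.2.le
  have c1 : ContinuousAt (wA γ n) b := by unfold wA; fun_prop
  have c2 : ContinuousAt (dA γ n) b := by unfold dA; fun_prop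
  have key : ∀ᶠ c in 𝓝 b, (wA γ n c < 0 ∨ wA γ (n+1) c < 0) := by
    by_cases h : wA γ n b < 0
    · filter_upwards [c1.eventually (gt_mem_nhds h)] with c hc using Or.inl hc
    · have hv := hw.resolve_left h
      have pf : 0 ≤ xA γ (n+1) b := by rw [xA_succ]; exact div_nonneg (not_lt.1 h) hd.le
      have cf : ContinuousAt (xA γ (n+1)) b := by
        have : ContinuousAt (fun b => wA γ n b / dA γ n b) b := ContinuousAt.div c1 c2 hd.ne'
        exact this
      have ch : ContinuousAt (yA γ (n+1)) b := by
        have : ContinuousAt (fun b => xA γ n b*(yA γ n b*(2*((n:ℝ)+1)+γ)+γ*xA γ (n+1) b)/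
          ((2-γ)*yA γ n b+(2*((n:ℝ)+1)+2-γ)*xA γ (n+1) b)) b := by
          refine ContinuousAt.div (by fun_prop) (by fun_prop) ?_
          exact (hden n h2 pf py).ne'
        exact this
      have cv : ContinuousAt (vA γ n) b := by unfold vA; fun_prop
      filter_upwards [cv.eventually (gt_mem_nhds hv)] with c hc using Or.inr hc
  filter_upwards [GA_open h0 h2 n hG, HA_open h0 h2 n (n+1) le_rfl hG hH, key]
    with c a1 a2 a3 using ⟨a1, a2, a3⟩

lemma HA_at {γ b : ℝ} {m n : ℕ} (h : m < n) (hH : HA γ n b) :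
    xA γ m b^2 < eA γ m b * yA γ m b := (HA_mono (Nat.succ_le_of_lt h) hH).2

lemma PQ_disj {γ b : ℝ} (h0 : 0 < γ) (h2 : γ < 2) (n m : ℕ) (hP : PA γ n b) (hQ : QA γ m b) :
    False := by
  obtain ⟨hG, hH, hw⟩ := hP
  rcases lt_trichotomy m (n+1) with h | h | h
  · exact lt_asymm (HA_at h hH) hQ.2
  · subst h
    have hw' := hw.resolve_left (not_lt.2 hQ.1.2.1.le)
    obtain ⟨pe, px, py⟩ := posA h0 h2 (n+1) hQ.1
    have := hQ.2
    unfold wA at hw'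
    nlinarith [mul_pos pe py, mul_pos (mul_pos pe py) py, mul_lt_mul_of_pos_right this py, mul_pos py (mul_pos px px), mul_pos pe (mul_pos px px)]
  · have g := GA_mono (by omega : n+2 ≤ m) hQ.1
    rcases hw with hw | hw
    · exact lt_asymm hw g.1.2.1
    · exact lt_asymm hw g.2.1

/-- basic comparison -/
lemma hlt {γ m X Y f h n1 : ℝ} (h1 : γ < 1) (hX : 0 < X) (hY : 0 < Y) (hf : 0 < f)
    (hYf : Y ≤ f) (hmn : n1 < m) (hn : 0 ≤ n1) (h0 : 0 < γ)
    (hh : h * ((2*n1+2-γ)*Y+(2*m+2-γ)*f) = X*(Y*(2*m+γ)+(2*n1+γ)*f)) : h < X := by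
  have hD : 0 < (2*n1+2-γ)*Y+(2*m+2-γ)*f := by
    apply add_pos <;> apply mul_pos <;> linarith
  by_contra hc
  push Not at hc
  have : X * ((2*n1+2-γ)*Y+(2*m+2-γ)*f) ≤ X*(Y*(2*m+γ)+(2*n1+γ)*f) := by
    rw [← hh]; exact mul_le_mul_of_nonneg_right hc hD.le
  have := le_of_mul_le_mul_left this hX
  nlinarith [mul_nonneg (sub_nonneg.2 hYf) (by linarith : 0 ≤ 2*m - 2*n1), mul_pos hY (by linarith : 0 < 1 - γ), mul_pos hf (by linarith : 0 < 1 - γ)]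

lemma yA_eq {γ b : ℝ} (h0 : 0 < γ) (h2 : γ < 2) (n : ℕ) (hG : GA γ (n+1) b) :
   yA γ (n+1) b * ((2*0+2-γ)*yA γ n b+(2*((n:ℝ)+1)+2-γ)*xA γ (n+1) b)
    = xA γ n b*(yA γ n b*(2*((n:ℝ)+1)+γ)+(2*0+γ)*xA γ (n+1) b) := by
  obtain ⟨pe, px, py⟩ := posA h0 h2 n hG.1
  obtain ⟨_, pf, _⟩ := posA h0 h2 (n+1) hG
  have := (hden n h2 pf.le py).ne'
  have e := (div_eq_iff this).1 (yA_succ γ n b).symm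
  linear_combination -e

lemma xA_eq {γ b : ℝ} (n : ℕ) (hG : GA γ (n+1) b) :
   (xA γ n b^2 - yA γ n b * eA γ n b)*(xA γ (n+1) b + yA γ n b) +
    (xA γ n b^2 - xA γ (n+1) b * yA γ n b) * (yA γ n b + eA γ n b) = 0 := by
  have hd := hG.2.2.ne'
  have : xA γ (n+1) b * dA γ n b = wA γ n b := by rw [xA_succ]; field_simp
  unfold dA wA at this
  linear_combination -this

lemma good {γ b : ℝ} (h0 : 0 < γ) (h1 : γ < 1) (hb : 0 < b) (hP : ∀ n, ¬ PA γ n b)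
    (hQ : ∀ n, ¬ QA γ n b) (n : ℕ) : GA γ n b ∧ HA γ n b := by
  have h2 : γ < 2 := by linarith
  induction n with
  | zero => exact ⟨hb, trivial⟩
  | succ n ih =>
    obtain ⟨hG, hH⟩ := ih
    obtain ⟨pe, px, py⟩ := posA h0 h2 n hG
    have hn : (0:ℝ) ≤ n := n.cast_nonneg
    have q : xA γ n b^2 ≤ eA γ n b * yA γ n b := by
      by_contra h; exact hQ n ⟨hG, not_le.1 h⟩
    have hd := dA_pos h0 h2 n hG q
    have q' : xA γ n b^2 < eA γ n b * yA γ n b := by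
      refine lt_of_le_of_ne q fun heq => ?_
      have hs : xA γ n b < eA γ n b := by
        by_contra hc
        push Not at hc
        cases n with
        | zero =>
          have e1 : eA γ 0 b = 1 := rfl
          have e2 : yA γ 0 b = γ/(2-γ) := rfl
          have : γ/(2-γ) < 1 := by rw [div_lt_one] <;> linarith
          rw [e1, e2] at heq
          rw [e1] at hc
          nlinarith
        | succ n =>
          obtain ⟨pe', px', py'⟩ := posA h0 h2 n hG.1
          have r := xA_eq n hG
          have hv := HA_at (Nat.lt_succ_self n) hH
          have hB : xA γ (n+1) b * yA γ n b ≤ xA γ n b^2 := by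
            by_contra hB
            nlinarith [mul_pos (sub_pos.2 hv) (add_pos px py'), mul_pos (sub_pos.2 (not_le.1 hB)) (add_pos py' pe')]
          rw [eA_succ] at hc heq
          have hYX : yA γ n b ≤ xA γ n b := by
            by_contra h
            nlinarith
          have hn' : (0:ℝ) ≤ n := n.cast_nonneg
          have := hlt h1 px' py' px (hYX.trans hc) (by linarith) le_rfl h0 (yA_eq h0 h2 n hG)
          nlinarith
      have hw : wA γ n b = eA γ n b * dA γ n b := by
        unfold wA dA; linear_combination (2 * yA γ n b + 2* eA γ n b) * heq
      have hG' : GA γ (n+1) b := ⟨hG, by rw [hw]; positivity, hd⟩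
      have hx' : xA γ (n+1) b = eA γ n b := by rw [xA_succ, hw]; field_simp
      have hYX : yA γ n b ≤ xA γ n b := by
        by_contra h
        nlinarith
      have := hlt h1 px py (by rw [hx']; exact pe) (by rw [hx']; linarith) (by linarith) le_rfl h0 (yA_eq h0 h2 n hG')
      refine hQ (n+1) ⟨hG', ?_⟩
      rw [eA_succ, hx']
      nlinarith
    have hH' : HA γ (n+1) b := ⟨hH, q'⟩
    refine ⟨⟨hG, ?_, hd⟩, hH'⟩
    by_contra hw
    apply hP n
    refine ⟨hG, hH', ?_⟩
    by_cases hw0 : wA γ n b < 0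
    · exact Or.inl hw0
    · right
      have : wA γ n b = 0 := by linarith
      have hx' : xA γ (n+1) b = 0 := by rw [xA_succ, this, zero_div]
      have hy' : 0 < yA γ (n+1) b := by
        have := hden n h2 (le_refl (0:ℝ)) py
        rw [yA_succ, hx']
        exact div_pos (by positivity) this
      unfold wA
      rw [hx', eA_succ]
      have := mul_pos px (mul_pos hy' hy')
      nlinarith

lemma exists_b {γ : ℝ} (h0 : 0 < γ) (h1 : γ < 1) :
    ∃ b, ∀ n, GA γ n b := by
  have h2 : γ < 2 := by linarith
  by_contra hcon
  push Not at hcon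
  have hc : 0 < γ/(2-γ) := div_pos h0 (by linarith)
  have hc1 : γ/(2-γ) < 1 := by rw [div_lt_one] <;> linarith
  obtain ⟨b, hb, ⟨n, hn⟩, ⟨m, hm⟩⟩ := isPreconnected_Ioi (a := (0:ℝ)) {b | ∃ n, PA γ n b} {b | ∃ n, QA γ n b}
    (by
      rw [isOpen_iff_mem_nhds]
      rintro b ⟨n, hn⟩
      filter_upwards [PA_open h0 h2 n hn] with c hc using ⟨n, hc⟩)
    (by
      rw [isOpen_iff_mem_nhds]
      rintro b ⟨n, hn⟩
      filter_upwards [QA_open h0 h2 n hn] with c hc using ⟨n, hc⟩)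
    (by
      intro b hb
      by_contra h
      rw [Set.mem_union, not_or] at h
      obtain ⟨n, hn⟩ := hcon b
      exact hn (good h0 h1 hb (fun n hn => h.1 ⟨n, hn⟩) (fun n hn => h.2 ⟨n, hn⟩) n).1)
    (by
      refine ⟨γ/(2-γ)/2, by simp only [Set.mem_Ioi]; positivity, 0, ?_, ⟨trivial, ?_⟩, Or.inl ?_⟩
      · show 0 < γ/(2-γ)/2
        positivity
      · show (γ/(2-γ)/2)^2 < 1 * (γ/(2-γ))
        nlinarith
      · show (2*(γ/(2-γ))+1)*(γ/(2-γ)/2)^2 - 1*(γ/(2-γ))^2 < 0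
        nlinarith [mul_pos hc hc])
    (by
      refine ⟨1, by simp, 0, ?_, ?_⟩
      · show (0:ℝ) < 1
        norm_num
      · show 1 * (γ/(2-γ)) < 1^2
        linarith)
  exact PQ_disj h0 h2 n m hn hm

def SqB (γ N M a b c d : ℝ) : Prop :=
  a * b * (-2 * M - γ) + b * d * (2 * (N + 1) - γ) + d * c * (2 * (M + 1) - γ) + c * a * (-2 * N - γ) = 0
/-- right equation at X: e below, f above, Y right -/
def RtB (N M X e f Y : ℝ) : Prop :=
  (N + M) * (X^2 - Y*e) * (f + Y) + (M - N) * (X^2 - f*Y) * (Y + e) = 0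

lemma horB {γ N M a b c d e f : ℝ} (ha : 0 < a) (hc : 0 < c) (hd : 0 < d)
    (he : 0 < e) (h1 : SqB γ N M a b c d) (h2 : SqB γ N (M+1) c d e f)
    (hR : RtB N (M+1) c a e d) : RtB (-(N+1)) (M+1) d b f c := by
  unfold SqB RtB at *
  have : c * (a+d) * (d+e) ≠ 0 := by positivity
  apply mul_left_cancel₀ this
  linear_combination (-d*(b+c)*(c+f)) * hR + (1/2)*(c^2+d^2)*(d+e)*(c+f) * h1 + (-1/2)*(c^2+d^2)*(a+d)*(b+c)*h2

def BotB (N M X e Y v : ℝ) : Prop :=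
  (M+N)*(X^2-Y*e)*(v+e) = (M-N)*(X^2-v*e)*(Y+e)
def TopB (N M X f Y v : ℝ) : Prop :=
  (M+N)*(X^2-v*f)*(Y+f) = (M-N)*(X^2-Y*f)*(v+f)

lemma verB {γ N M a b c d g h : ℝ} (ha : 0 < a) (hb : 0 < b) (hd : 0 < d)
    (hg : 0 < g) (h1 : SqB γ N M a b c d) (h2 : SqB γ (N+1) M b g d h)
    (hT : TopB (N+1) M b d g a) : BotB (N+1) (M+1) d b h c := by
  unfold SqB TopB BotB at *
  have : b * (a+d) * (g+d) ≠ 0 := by positivity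
  apply mul_left_cancel₀ this
  linear_combination (-d*(b+c)*(b+h)) * hT + (1/2)*(b^2+d^2)*(g+d)*(b+h) * h1 + (-1/2)*(b^2+d^2)*(a+d)*(b+c)*h2

lemma locB {N M X e f Y v : ℝ} (hP : 0 < M + N) (he : 0 < e) (hv : 0 < v)
    (hL : RtB (-N) M X e f v) (hB : BotB N M X e Y v) :
    RtB N M X e f Y ∧ TopB N M X f Y v := by
  unfold RtB BotB TopB at *
  have hS : (X^2-Y*e)*(f+v)+(X^2-f*v)*(Y+e) = 0 := by
    have : (M+N)*(v+e) ≠ 0 := by positivity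
    apply mul_left_cancel₀ this
    linear_combination (f+v)*hB + (Y+e)*hL
  have h3 : v+e ≠ 0 := by positivity
  constructor
  · apply mul_left_cancel₀ h3
    linear_combination (f+Y)*hB + (M-N)*(Y+e)*hS
  · apply mul_left_cancel₀ h3
    linear_combination (f+Y)*hL - (M-N)*(f+v)*hS

noncomputable def nextB (γ : ℝ) (N : ℕ) (c : ℕ → ℝ) : ℕ → ℝ
  | 0 => (2*(N:ℝ)+γ)/(2*((N:ℝ)+1)-γ) * c 0
  | k+1 => c (k+1)*(nextB γ N c k *(2*((N:ℝ)+(k:ℝ)+1)+γ)+(2*(N:ℝ)+γ)*c (k+2))/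
      ((2*(N:ℝ)+2-γ)*nextB γ N c k+(2*((N:ℝ)+(k:ℝ)+1)+2-γ)*c (k+2))
noncomputable def rB (γ : ℝ) (c : ℕ → ℝ) : ℕ → ℕ → ℝ
  | 0 => c
  | N+1 => nextB γ N (rB γ c N)

lemma denB {γ x y : ℝ} (N k : ℕ) (h2 : γ < 2) (hx : 0 < x) (hy : 0 < y) :
    0 < (2*(N:ℝ)+2-γ)*y+(2*((N:ℝ)+(k:ℝ)+1)+2-γ)*x := by
  have hn : (0:ℝ) ≤ N := N.cast_nonneg
  have hk : (0:ℝ) ≤ k := k.cast_nonneg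
  apply add_pos <;> apply mul_pos <;> linarith

lemma posnB {γ : ℝ} (h0 : 0 < γ) (h2 : γ < 2) {N : ℕ} {c : ℕ → ℝ} (hc : ∀ k, 0 < c k) (k : ℕ) :
    0 < nextB γ N c k := by
  have hn : (0:ℝ) ≤ N := N.cast_nonneg
  induction k with
  | zero => exact mul_pos (div_pos (by positivity) (by linarith)) (hc 0)
  | succ k ih =>
    have := hc (k+1)
    have := hc (k+2)
    exact div_pos (by positivity) (denB N k h2 (hc _) ih)

lemma posB {γ : ℝ} (h0 : 0 < γ) (h2 : γ < 2) {c : ℕ → ℝ} (hc : ∀ k, 0 < c k) (N k : ℕ) :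
    0 < rB γ c N k := by
  induction N generalizing k with
  | zero => exact hc k
  | succ N ih => exact posnB h0 h2 ih k

lemma sqB {γ : ℝ} (h0 : 0 < γ) (h2 : γ < 2) {c : ℕ → ℝ} (hc : ∀ k, 0 < c k) (N k : ℕ) :
    SqB γ N ((N:ℝ)+k+1) (rB γ c N (k+1)) (rB γ c (N+1) k) (rB γ c N (k+2)) (rB γ c (N+1) (k+1)) := by
  have := (denB N k h2 (posB h0 h2 hc N (k+2)) (posB h0 h2 hc (N+1) k)).ne'
  have e : rB γ c (N+1) (k+1) = rB γ c N (k+1)*(rB γ c (N+1) k *(2*((N:ℝ)+(k:ℝ)+1)+γ)+(2*(N:ℝ)+γ)*rB γ c N (k+2))/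
      ((2*(N:ℝ)+2-γ)*rB γ c (N+1) k+(2*((N:ℝ)+(k:ℝ)+1)+2-γ)*rB γ c N (k+2)) := rfl
  rw [eq_div_iff this] at e
  unfold SqB
  linear_combination e

lemma sqB0 {γ : ℝ} (h2 : γ < 2) {c : ℕ → ℝ} (N : ℕ) (t y : ℝ) :
    SqB γ N N (rB γ c N 0) t y (rB γ c (N+1) 0) := by
  have hn : (0:ℝ) ≤ N := N.cast_nonneg
  have e : rB γ c (N+1) 0 = (2*(N:ℝ)+γ)/(2*((N:ℝ)+1)-γ) * rB γ c N 0 := rfl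
  have : (2*((N:ℝ)+1)-γ) ≠ 0 := by linarith
  rw [div_mul_eq_mul_div, eq_div_iff this] at e
  unfold SqB
  linear_combination (t+y)*e

lemma leftB {γ : ℝ} (h0 : 0 < γ) (h2 : γ < 2) {c : ℕ → ℝ} (hc : ∀ k, 0 < c k) (N : ℕ)
    (hR : ∀ k : ℕ, RtB N ((N:ℝ)+k+1) (rB γ c N (k+1)) (rB γ c N k) (rB γ c N (k+2)) (rB γ c (N+1) k)) (k : ℕ) :
    RtB (-((N:ℝ)+1)) ((N:ℝ)+1+k+1) (rB γ c (N+1) (k+1)) (rB γ c (N+1) k) (rB γ c (N+1) (k+2)) (rB γ c N (k+2)) := by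
  have p := posB h0 h2 hc
  have s1 := sqB h0 h2 hc N k
  have s2 := sqB h0 h2 hc N (k+1)
  have r := hR (k+1)
  push_cast at s2 r
  have := horB (p _ _) (p _ _) (p _ _) (p N (k+3)) s1 (by convert s2 using 1; ring) (by convert r using 1; ring)
  convert this using 1; ring

lemma rightB {γ : ℝ} (h0 : 0 < γ) (h2 : γ < 2) {c : ℕ → ℝ} (hc : ∀ k, 0 < c k)
    (hR : ∀ k : ℕ, RtB 0 ((k:ℝ)+1) (c (k+1)) (c k) (c (k+2)) (rB γ c 1 k)) (N k : ℕ) :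
    RtB N ((N:ℝ)+k+1) (rB γ c N (k+1)) (rB γ c N k) (rB γ c N (k+2)) (rB γ c (N+1) k) := by
  have p := posB h0 h2 hc
  induction N generalizing k with
  | zero =>
    have := hR k
    simp only [Nat.cast_zero, zero_add]
    exact this
  | succ N ih =>
    have hn : (0:ℝ) ≤ N := N.cast_nonneg
    have hL := leftB h0 h2 hc N ih
    have key : BotB ((N:ℝ)+1) ((N:ℝ)+1+k+1) (rB γ c (N+1) (k+1)) (rB γ c (N+1) k) (rB γ c (N+2) k) (rB γ c N (k+2)) := by
      induction k with
      | zero =>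
        have r := ih 0
        have s1 := sqB0 (γ := γ) (c := c) h2 N 1 (rB γ c N 1)
        have s2 := sqB h0 h2 hc N 0
        simp only [Nat.cast_zero, add_zero, zero_add] at r s2
        have l0 := horB (p N 0) (p N 1) (p (N+1) 0) (p N 2) s1 s2 r
        have t0 : TopB ((N:ℝ)+1) ((N:ℝ)+1) (rB γ c (N+1) 0) (rB γ c (N+1) 1) 1 (rB γ c N 1) := by
          unfold RtB at l0; unfold TopB
          have : rB γ c N 1 + 1 ≠ 0 := by have := p N 1; positivity
          apply mul_left_cancel₀ this
          linear_combination (1 + rB γ c (N+1) 1) * l0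
        have s3 := sqB0 (γ := γ) (c := c) h2 (N+1) 1 (rB γ c (N+1) 1)
        push_cast at s3
        have := verB (p N 1) (p (N+1) 0) (p (N+1) 1) one_pos s2 s3 t0
        simpa using this
      | succ k ihk =>
        have hk : (0:ℝ) ≤ k := k.cast_nonneg
        have t := (locB (by linarith) (p _ _) (p _ _) (hL k) ihk).2
        have s1 := sqB h0 h2 hc N (k+1)
        have s2 := sqB h0 h2 hc (N+1) k
        push_cast at s1 s2
        have := verB (p _ _) (p _ _) (p _ _) (p _ _) (by convert s1 using 1; ring) s2 t
        convert this using 1; push_cast; ring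
    have hk : (0:ℝ) ≤ k := k.cast_nonneg
    have := (locB (by linarith) (p _ _) (p _ _) (hL k) key).1
    push_cast
    exact this

/-- comparison in the bad region -/
lemma stepC {γ n m X e f Y h : ℝ} (h0 : 0 < γ) (h1 : γ < 1) (hn : 0 ≤ n) (hm : n < m)
    (hX : 0 < X) (he : 0 < e) (hf : 0 < f) (hY : 0 < Y) (hh : 0 < h)
    (hS : SqB γ n m X Y f h) (hR : RtB n m X e f Y) (hb : Y * e < X^2) :
    X^2 < f*Y ∧ (h/f) * ((2*n+2-γ)*(Y/X)^2 + (2*m+2-γ)) ≤ (Y/X) * ((2*m+γ)*(Y/X)^2+(2*n+γ)) := by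
  have hB : X^2 < f*Y := by
    unfold RtB at hR
    by_contra hc
    push Not at hc
    have : 0 < (n+m)*(X^2-Y*e)*(f+Y) := by
      apply mul_pos (mul_pos _ _) <;> linarith
    have : 0 ≤ (m-n)*(X^2-f*Y)*(Y+e) := by
      apply mul_nonneg (mul_nonneg _ _) <;> linarith
    linarith
  refine ⟨hB, ?_⟩
  have hS' : h * ((2*n+2-γ)*Y+(2*m+2-γ)*f) = X*(Y*(2*m+γ)+(2*n+γ)*f) := by
    unfold SqB at hS; linear_combination hS
  have p1 : 0 < 2*n+2-γ := by linarith
  have p2 : 0 < 2*m+2-γ := by linarith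
  have p3 : 0 < 2*m+γ := by linarith
  have p4 : 0 < 2*n+γ := by linarith
  have hD : 0 < (2*n+2-γ)*Y+(2*m+2-γ)*f := by positivity
  have hh' : h = X*(Y*(2*m+γ)+(2*n+γ)*f)/((2*n+2-γ)*Y+(2*m+2-γ)*f) := by
    rw [eq_div_iff hD.ne']; exact hS'
  have e1 : (h/f) * ((2*n+2-γ)*(Y/X)^2 + (2*m+2-γ)) = h * ((2*n+2-γ)*Y^2+(2*m+2-γ)*X^2) / (f*X^2) := by
    field_simp
  have e2 : (Y/X) * ((2*m+γ)*(Y/X)^2+(2*n+γ)) = Y*((2*m+γ)*Y^2+(2*n+γ)*X^2)/X^3 := by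
    field_simp
  rw [e1, e2, div_le_div_iff₀ (by positivity) (by positivity)]
  have hcross : 0 ≤ (2*m+γ)*(2*m+2-γ) - (2*n+γ)*(2*n+2-γ) := by nlinarith
  -- replace f by X^2/Y
  have key : (Y*(2*m+γ)+(2*n+γ)*f) * ((2*n+2-γ)*Y^2+(2*m+2-γ)*X^2) ≤
      ((2*m+γ)*Y^2+(2*n+γ)*X^2) * ((2*n+2-γ)*Y+(2*m+2-γ)*f) := by
    have := mul_nonneg hcross (mul_nonneg hY.le (sub_nonneg.2 hB.le))
    nlinarith
  have key2 : h * ((2*n+2-γ)*Y^2+(2*m+2-γ)*X^2) ≤ X * ((2*m+γ)*Y^2+(2*n+γ)*X^2) := by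
    have : (h * ((2*n+2-γ)*Y^2+(2*m+2-γ)*X^2)) * ((2*n+2-γ)*Y+(2*m+2-γ)*f) ≤ (X * ((2*m+γ)*Y^2+(2*n+γ)*X^2)) * ((2*n+2-γ)*Y+(2*m+2-γ)*f) := by
      have := mul_le_mul_of_nonneg_left key hX.le
      linear_combination this + ((2*n+2-γ)*Y^2+(2*m+2-γ)*X^2) * hS'
    exact le_of_mul_le_mul_right this hD
  calc h * ((2*n+2-γ)*Y^2+(2*m+2-γ)*X^2) * X^3 ≤ X * ((2*m+γ)*Y^2+(2*n+γ)*X^2) * X^3 :=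
        mul_le_mul_of_nonneg_right key2 (by positivity)
    _ = (X^2) * (((2*m+γ)*Y^2+(2*n+γ)*X^2) * X^2) := by ring
    _ ≤ (f*Y) * (((2*m+γ)*Y^2+(2*n+γ)*X^2) * X^2) := mul_le_mul_of_nonneg_right hB.le (by positivity)
    _ = _ := by ring

lemma finC {N k x e f y : ℝ} (hn : 0 ≤ N) (hk' : 0 ≤ k) (he : 0 < e) (hx : 0 < x) (hf : 0 < f)
    (hy : 0 < y) (g3 : e < 1/2*x) (g2 : y < 1/2*x) (r : RtB N (N+(k+1)+1) x e f y) : False := by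
  unfold RtB at r
  have c1 : y * e ≤ 1/4 * x^2 := by
    have := mul_le_mul g2.le g3.le he.le (by positivity)
    linarith
  have c2 : y^2 ≤ 1/4 * x^2 := by
    have := mul_le_mul g2.le g2.le hy.le (by positivity)
    linarith
  have i3 : 0 < x^2 - y*e := by have := mul_pos hx hx; linarith
  have num : 0 < (2*N+k+2)*(x^2-y*e)*y + (k+2)*x^2*(y+e) := by positivity
  have den : 0 ≤ (2*N+k+2)*(x^2-y*e) - (k+2)*(y^2+y*e) := by
    have q1 : (2*N+k+2)*(3/4*x^2) ≤ (2*N+k+2)*(x^2-y*e) := mul_le_mul_of_nonneg_left (by linarith) (by positivity)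
    have q2 : (k+2)*(y^2+y*e) ≤ (k+2)*(1/2*x^2) := mul_le_mul_of_nonneg_left (by linarith) (by positivity)
    have := mul_nonneg hn (sq_nonneg x)
    have := mul_nonneg hk' (sq_nonneg x)
    linarith [sq_nonneg x]
  have := mul_nonneg hf.le den
  linarith

lemma badC {γ : ℝ} (h0 : 0 < γ) (h1 : γ < 1) (N : ℕ) (X Y : ℕ → ℝ) (hX : ∀ k, 0 < X k)
    (hY : ∀ k, 0 < Y k)
    (hS : ∀ k : ℕ, SqB γ N ((N:ℝ)+k+1) (X (k+1)) (Y k) (X (k+2)) (Y (k+1)))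
    (hR : ∀ k : ℕ, RtB N ((N:ℝ)+k+1) (X (k+1)) (X k) (X (k+2)) (Y k))
    (k0 : ℕ) (hk : Y k0 * X k0 < X (k0+1)^2) (ht : Y k0 ≤ X (k0+1)) : False := by
  have hn : (0:ℝ) ≤ N := N.cast_nonneg
  set T : ℕ → ℝ := fun k => Y k / X (k+1) with hT
  have Tpos : ∀ k, 0 < T k := fun k => div_pos (hY _) (hX _)
  have st : ∀ k, Y k * X k < X (k+1)^2 → X (k+1)^2 < X (k+2) * Y k ∧
      T (k+1) * ((2*(N:ℝ)+2-γ)*(T k)^2 + (2*((N:ℝ)+k+1)+2-γ)) ≤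
        T k * ((2*((N:ℝ)+k+1)+γ)*(T k)^2+(2*(N:ℝ)+γ)) := by
    intro k hk
    have hk' : (0:ℝ) ≤ k := k.cast_nonneg
    exact stepC h0 h1 hn (by linarith) (hX _) (hX _) (hX _) (hY _) (hY _) (hS k) (hR k) hk
  have dec : ∀ k, Y k * X k < X (k+1)^2 → T k ≤ 1 → T (k+1) < T k ∧ Y (k+1) * X (k+1) < X (k+2)^2 := by
    intro k hk h
    have hk' : (0:ℝ) ≤ k := k.cast_nonneg
    obtain ⟨a1, a2⟩ := st k hk
    have tp := Tpos k
    have lt : T (k+1) < T k := by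
      by_contra hc
      push Not at hc
      have p1 : 0 < (2*(N:ℝ)+2-γ)*(T k)^2 + (2*((N:ℝ)+k+1)+2-γ) := by
        have : 0 < (2*(N:ℝ)+2-γ) := by linarith
        have : 0 < (2*((N:ℝ)+k+1)+2-γ) := by linarith
        positivity
      have := le_of_mul_le_mul_left ((mul_le_mul_of_nonneg_right hc p1.le).trans a2) tp
      have t2 : (T k)^2 ≤ 1 := by nlinarith
      nlinarith [mul_nonneg (by linarith : 0 ≤ (2*(k:ℝ)+2)) (sub_nonneg.2 t2), mul_nonneg (by linarith : 0 ≤ 1 - γ) (sq_nonneg (T k))]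
    refine ⟨lt, ?_⟩
    have x1 := hX (k+1)
    have x2 := hX (k+2)
    have y1 : Y k ≤ X (k+1) := by
      have := (div_le_one x1).1 h
      exact this
    have y2 : Y (k+1) * X (k+1) < Y k * X (k+2) := by
      have := (div_lt_div_iff₀ x2 x1).1 lt
      exact this
    have : Y k < X (k+2) := by
      by_contra hc
      push Not at hc
      nlinarith
    nlinarith
  have inv : ∀ j, Y (k0+j) * X (k0+j) < X (k0+j+1)^2 ∧ T (k0+j) ≤ 1 := by
    intro j
    induction j with
    | zero => exact ⟨hk, (div_le_one (hX _)).2 ht⟩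
    | succ j ih =>
      obtain ⟨a, b⟩ := dec _ ih.1 ih.2
      exact ⟨b, a.le.trans ih.2⟩
  have anti : ∀ j, T (k0+j+1) ≤ T (k0+1) := by
    intro j
    induction j with
    | zero => exact le_rfl
    | succ j ih => exact (dec _ (inv (j+1)).1 (inv (j+1)).2).1.le.trans ih
  have τ1 : T (k0+1) < 1 := (dec _ (inv 0).1 (inv 0).2).1.trans_le (inv 0).2
  set τ := T (k0+1)
  have τ0 : 0 < τ := Tpos _
  have hτ2 : τ^2 < 1 := by nlinarith
  set ρ := (1+τ^2)/2 with hρ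
  have ρ1 : ρ < 1 := by rw [hρ]; linarith
  have ρ0 : 0 < ρ := by positivity
  obtain ⟨K, hK⟩ := exists_nat_ge ((2*(N:ℝ)+2)/(1-τ^2))
  rw [div_le_iff₀ (by linarith)] at hK
  have geo : ∀ j, K ≤ j → T (k0+j+2) ≤ ρ * T (k0+j+1) := by
    intro j hj
    have hjK : (K:ℝ) ≤ j := by exact_mod_cast hj
    obtain ⟨a1, a2⟩ := st (k0+j+1) (inv (j+1)).1
    have hk0 : (0:ℝ) ≤ k0 := k0.cast_nonneg
    have tp := Tpos (k0+j+1)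
    have tp2 := Tpos (k0+j+2)
    have tt := anti j
    have t2 : T (k0+j+1)^2 ≤ τ^2 := pow_le_pow_left₀ tp.le tt 2
    push_cast at a2
    set m : ℝ := (N:ℝ)+(k0+j+1)+1 with hm
    have hmj : (K:ℝ) ≤ m := by rw [hm]; linarith
    have hmK : 2*(N:ℝ)+2 ≤ m*(1-τ^2) := hK.trans (mul_le_mul_of_nonneg_right hmj (by linarith))
    have hm0 : 0 ≤ m := by rw [hm]; positivity
    have p2 : 0 < 2*m+2-γ := by linarith
    have b1 : T (k0+j+2) * (2*m+2-γ) ≤ T (k0+j+2) * ((2*(N:ℝ)+2-γ)*T (k0+j+1)^2 + (2*m+2-γ)) := by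
      apply mul_le_mul_of_nonneg_left _ tp2.le
      have : 0 ≤ (2*(N:ℝ)+2-γ)*T (k0+j+1)^2 := mul_nonneg (by linarith) (sq_nonneg _)
      linarith
    have b2 : (2*m+γ)*T (k0+j+1)^2+(2*(N:ℝ)+γ) ≤ ρ * (2*m+2-γ) := by
      have : (2*m+γ)*T (k0+j+1)^2 ≤ (2*m+γ)*τ^2 := mul_le_mul_of_nonneg_left t2 (by linarith)
      rw [hρ]
      nlinarith
    have b3 := (b1.trans a2).trans (mul_le_mul_of_nonneg_left b2 tp.le)
    have : T (k0+j+2) * (2*m+2-γ) ≤ (ρ * T (k0+j+1)) * (2*m+2-γ) := by linarith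
    exact le_of_mul_le_mul_right this p2
  have geo2 : ∀ i, T (k0+(K+i)+1) ≤ ρ^i := by
    intro i
    induction i with
    | zero =>
      rw [pow_zero]
      exact (inv (K+1)).2
    | succ i ih =>
      have := geo (K+i) (by omega)
      calc T (k0+(K+(i+1))+1) ≤ ρ * T (k0+(K+i)+1) := this
        _ ≤ ρ * ρ^i := mul_le_mul_of_nonneg_left ih ρ0.le
        _ = _ := by ring
  obtain ⟨i, hi⟩ := exists_pow_lt_of_lt_one (by norm_num : (0:ℝ) < 1/2) ρ1
  set k := k0+(K+i)+1 with hkdef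
  have hTk : T k < 1/2 := (geo2 i).trans_lt hi
  have i1 := inv (K+i+1)
  have i2 := inv (K+i+2)
  have ek : k0 + (K+i+1) = k := by omega
  have ek2 : k0 + (K+i+2) = k+1 := by omega
  rw [ek] at i1
  rw [ek2] at i2
  have hT1 := (dec k i1.1 i1.2).1
  have f1 := (st k i1.1).1
  have r := hR (k+1)
  have x0 := hX (k+1)
  have x1 := hX (k+2)
  have x2 := hX (k+3)
  have y0 := hY k
  have y1 := hY (k+1)
  have g1 : Y k < 1/2 * X (k+1) := (div_lt_iff₀ x0).1 hTk
  have g2 : Y (k+1) < 1/2 * X (k+2) := (div_lt_iff₀ x1).1 (hT1.trans hTk)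
  have g3 : X (k+1) < 1/2 * X (k+2) := by
    by_contra hc
    push Not at hc
    nlinarith
  have hk' : (0:ℝ) ≤ k := k.cast_nonneg
  push_cast at r
  exact finC hn hk' x0 x1 x2 y1 g3 g2 r

lemma signC {γ : ℝ} (h0 : 0 < γ) (h1 : γ < 1) (N : ℕ) (X Y : ℕ → ℝ) (hX : ∀ k, 0 < X k)
    (hY : ∀ k, 0 < Y k)
    (hS : ∀ k : ℕ, SqB γ N ((N:ℝ)+k+1) (X (k+1)) (Y k) (X (k+2)) (Y (k+1)))
    (hR : ∀ k : ℕ, RtB N ((N:ℝ)+k+1) (X (k+1)) (X k) (X (k+2)) (Y k))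
    (hst : Y 0 ≤ X 0) (k : ℕ) : X (k+1)^2 ≤ Y k * X k := by
  have hn : (0:ℝ) ≤ N := N.cast_nonneg
  induction k with
  | zero =>
    by_contra hc
    push Not at hc
    have := hX 0; have := hX 1; have := hY 0
    refine badC h0 h1 N X Y hX hY hS hR 0 hc ?_
    simp only [zero_add]
    simp only [zero_add] at hc
    by_contra hd
    push Not at hd
    nlinarith
  | succ k ih =>
    by_contra hc
    push Not at hc
    have x0 := hX k; have x1 := hX (k+1); have x2 := hX (k+2)
    have y0 := hY k; have y1 := hY (k+1)
    have hk' : (0:ℝ) ≤ k := k.cast_nonneg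
    refine badC h0 h1 N X Y hX hY hS hR (k+1) hc ?_
    change Y (k+1) ≤ X (k+2)
    change Y (k+1) * X (k+1) < X (k+2)^2 at hc
    rcases le_or_gt (X (k+2)) (X (k+1)) with h | h
    · by_contra hd
      push Not at hd
      nlinarith
    · have hB : X (k+2) * Y k ≤ X (k+1)^2 := by
        have r := hR k
        unfold RtB at r
        by_contra hB
        push Not at hB
        have q1 : 0 ≤ ((N:ℝ) + ((N:ℝ)+k+1)) * (Y k * X k - X (k+1)^2) * (X (k+2) + Y k) := by
          have := sub_nonneg.2 ih
          positivity
        have q2 : 0 < (((N:ℝ)+k+1) - (N:ℝ)) * (X (k+2) * Y k - X (k+1)^2) * (Y k + X k) := by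
          have := sub_pos.2 hB
          have : (0:ℝ) < ((N:ℝ)+k+1) - (N:ℝ) := by linarith
          positivity
        linarith
      have hYX : Y k ≤ X (k+1) := by
        by_contra h'
        push Not at h'
        nlinarith
      have s := hS k
      unfold SqB at s
      have := hlt (h := Y (k+1)) h1 x1 y0 x2 (hYX.trans h.le) (by linarith : (N:ℝ) < (N:ℝ)+k+1) hn h0 (by linear_combination s)
      linarith


/-- the assembled family on the natural-number quadrant -/
lemma existsD {γ : ℝ} (h0 : 0 < γ) (h1 : γ < 1) : ∃ r : ℕ → ℕ → ℝ, r 0 0 = 1 ∧ (∀ N k, 0 < r N k) ∧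
    (∀ N k : ℕ, SqB γ N ((N:ℝ)+k+1) (r N (k+1)) (r (N+1) k) (r N (k+2)) (r (N+1) (k+1))) ∧
    (∀ N, r (N+1) 0 = (2*(N:ℝ)+γ)/(2*((N:ℝ)+1)-γ) * r N 0) ∧
    (∀ N k : ℕ, RtB N ((N:ℝ)+k+1) (r N (k+1)) (r N k) (r N (k+2)) (r (N+1) k)) ∧
    (∀ N k : ℕ, RtB (-((N:ℝ)+1)) ((N:ℝ)+1+k+1) (r (N+1) (k+1)) (r (N+1) k) (r (N+1) (k+2)) (r N (k+2))) ∧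
    (∀ N k : ℕ, r N (k+1)^2 ≤ r N k * r (N+1) k) ∧
    (∀ N k : ℕ, r (N+1) (k+1)^2 ≤ r (N+1) k * r N (k+2)) := by
  have h2 : γ < 2 := by linarith
  obtain ⟨b, hb⟩ := exists_b h0 h1
  have hc : ∀ k, 0 < eA γ k b := fun k => (posA h0 h2 k (hb k)).1
  set c : ℕ → ℝ := fun k => eA γ k b with hcd
  have hY : ∀ k, rB γ c 1 k = yA γ k b := by
    intro k
    induction k with
    | zero =>
      show (2*((0:ℕ):ℝ)+γ)/(2*(((0:ℕ):ℝ)+1)-γ) * 1 = γ/(2-γ)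
      simp
    | succ k ih =>
      rw [yA_succ, ← ih]
      show xA γ k b*(rB γ c 1 k *(2*(((0:ℕ):ℝ)+(k:ℝ)+1)+γ)+(2*((0:ℕ):ℝ)+γ)*xA γ (k+1) b)/
        ((2*((0:ℕ):ℝ)+2-γ)*rB γ c 1 k+(2*(((0:ℕ):ℝ)+(k:ℝ)+1)+2-γ)*xA γ (k+1) b) = _
      simp
  have hR0 : ∀ k : ℕ, RtB 0 ((k:ℝ)+1) (c (k+1)) (c k) (c (k+2)) (rB γ c 1 k) := by
    intro k
    rw [hY]
    have := xA_eq k (hb (k+1))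
    show (0 + ((k:ℝ)+1)) * (xA γ k b^2 - yA γ k b * eA γ k b) * (xA γ (k+1) b + yA γ k b) +
      ((k:ℝ)+1-0) * (xA γ k b^2 - xA γ (k+1) b * yA γ k b) * (yA γ k b + eA γ k b) = 0
    linear_combination ((k:ℝ)+1) * this
  have hp := posB h0 h2 hc
  have hS := sqB h0 h2 hc
  have hR := rightB h0 h2 hc hR0
  have hL := fun N => leftB h0 h2 hc N (hR N)
  have hA : ∀ N k : ℕ, rB γ c N (k+1)^2 ≤ rB γ c N k * rB γ c (N+1) k := by
    intro N k
    rw [mul_comm]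
    refine signC h0 h1 N (rB γ c N) (rB γ c (N+1)) (hp _) (hp _) (hS N) (hR N) ?_ k
    have hn : (0:ℝ) ≤ N := N.cast_nonneg
    show (2*(N:ℝ)+γ)/(2*((N:ℝ)+1)-γ) * rB γ c N 0 ≤ rB γ c N 0
    have : (2*(N:ℝ)+γ)/(2*((N:ℝ)+1)-γ) ≤ 1 := by
      rw [div_le_one] <;> linarith
    have := mul_le_mul_of_nonneg_right this (hp N 0).le
    linarith
  refine ⟨rB γ c, rfl, hp, hS, fun N => rfl, hR, hL, hA, ?_⟩
  intro N k
  have l := hL N k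
  have r := hR (N+1) k
  have a := hA (N+1) k
  have pX := hp (N+1) (k+1)
  have pe := hp (N+1) k
  have pf := hp (N+1) (k+2)
  have pY := hp (N+2) k
  have pv := hp N (k+2)
  have hn : (0:ℝ) ≤ N := N.cast_nonneg
  have hk : (0:ℝ) ≤ k := k.cast_nonneg
  generalize rB γ c (N+1) (k+1) = X at *
  generalize rB γ c (N+1) (k+2) = f at *
  generalize rB γ c (N+1) k = e at *
  generalize rB γ c N (k+2) = v at *
  change X^2 ≤ e * rB γ c (N+2) k at a
  change RtB _ _ X e f (rB γ c (N+2) k) at r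
  generalize rB γ c (N+2) k = Y at *
  unfold RtB at l r
  push_cast at r
  by_contra hcon
  push Not at hcon
  have b1 : f * Y ≤ X^2 := by
    by_contra h
    push Not at h
    have q1 : 0 ≤ ((N:ℝ)+1+((N:ℝ)+1+k+1)) * (e*Y - X^2) * (f+Y) := by
      have := sub_nonneg.2 a
      positivity
    have q2 : 0 < ((k:ℝ)+1) * (f*Y - X^2) * (Y+e) := by
      have := sub_pos.2 h
      positivity
    linarith
  have b2 : X^2 < f * v := by
    by_contra h
    push Not at h
    have q1 : 0 < ((k:ℝ)+1) * (X^2-e*v) * (f+v) := by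
      have := sub_pos.2 hcon
      positivity
    have q2 : 0 ≤ ((N:ℝ)+1+k+1+((N:ℝ)+1)) * (X^2-f*v) * (v+e) := by
      have := sub_nonneg.2 h
      positivity
    linarith
  have c1 : f ≤ e := by
    by_contra h
    push Not at h
    have := mul_lt_mul_of_pos_right h pY
    linarith
  have := mul_le_mul_of_nonneg_right c1 pv.le
  linarith

lemma mainD {γ : ℝ} (h0 : 0 < γ) (h1 : γ < 1) : ∃ R : ℤ → ℤ → ℝ, R 0 0 = 1 ∧
    (∀ N M, 0 < R N M) ∧ IsRadiiSolution γ R ∧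
    ∀ N M, inVint N M → R N M^2 ≤ R N (M-1) * R (N+1) M := by
  obtain ⟨r, r0, hp, hS, hrec, hR, hL, hA, hA'⟩ := existsD h0 h1
  set R : ℤ → ℤ → ℝ := fun N M => r N.natAbs (M - |N|).toNat with hRd
  have e1 : ∀ (n k : ℕ) (N M : ℤ), N = n → M = n + k → R N M = r n k := by
    rintro n k N M rfl rfl
    simp [hRd]
  have e2 : ∀ (n k : ℕ) (N M : ℤ), N = -n → M = n + k → R N M = r n k := by
    rintro n k N M rfl rfl
    simp [hRd]
  refine ⟨R, by rw [e1 0 0 0 0 rfl rfl, r0], fun N M => hp _ _, ⟨?_, ?_, ?_⟩, ?_⟩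
  · intro N M a1 a2 a3 a4
    unfold inV at *
    unfold SquareEq
    rcases le_or_gt 0 N with h | h
    · obtain ⟨n, rfl⟩ := Int.eq_ofNat_of_zero_le h
      obtain ⟨k, hk⟩ := Int.eq_ofNat_of_zero_le (by rw [abs_of_nonneg (by omega)] at a2; omega : 0 ≤ M - n - 1)
      obtain rfl : M = n + k + 1 := by omega
      rw [e1 n (k+1) n (n+k+1) rfl (by push_cast; ring), e1 (n+1) k (n+1) (n+k+1) (by push_cast; ring) (by push_cast; ring), e1 n (k+2) n (n+k+1+1) rfl (by push_cast; ring), e1 (n+1) (k+1) (n+1) (n+k+1+1) (by push_cast; ring) (by push_cast; ring)]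
      have := hS n k
      unfold SqB at this
      push_cast
      linear_combination this
    · obtain ⟨n, hn⟩ := Int.eq_ofNat_of_zero_le (by omega : 0 ≤ -N - 1)
      obtain rfl : N = -n - 1 := by omega
      obtain ⟨k, hk⟩ := Int.eq_ofNat_of_zero_le (by rw [abs_of_neg h] at a1; omega : 0 ≤ M - n - 1)
      obtain rfl : M = n + k + 1 := by omega
      rw [e2 (n+1) k (-n-1) (n+k+1) (by push_cast; ring) (by push_cast; ring), e2 n (k+1) (-n-1+1) (n+k+1) (by push_cast; ring) (by push_cast; ring), e2 (n+1) (k+1) (-n-1) (n+k+1+1) (by push_cast; ring) (by push_cast; ring), e2 n (k+2) (-n-1+1) (n+k+1+1) (by push_cast; ring) (by push_cast; ring)]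
      have := hS n k
      unfold SqB at this
      push_cast
      linear_combination this
  · intro N
    rw [e1 (N+1) 0 _ _ (by push_cast; ring) (by push_cast; ring), e1 N 0 _ _ rfl (by simp),
      e2 (N+1) 0 _ _ (by push_cast; ring) (by push_cast; ring), e2 N 0 _ _ rfl (by simp)]
    exact ⟨hrec N, hrec N⟩
  · intro N M a
    unfold inVint at a
    unfold RiEq
    rcases le_or_gt 0 N with h | h
    · obtain ⟨n, rfl⟩ := Int.eq_ofNat_of_zero_le h
      obtain ⟨k, hk⟩ := Int.eq_ofNat_of_zero_le (by rw [abs_of_nonneg h] at a; omega : 0 ≤ M - n - 1)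
      obtain rfl : M = n + k + 1 := by omega
      rw [e1 n (k+1) n (n+k+1) rfl (by push_cast; ring), e1 (n+1) k (n+1) (n+k+1) (by push_cast; ring) (by push_cast; ring), e1 n (k+2) n (n+k+1+1) rfl (by push_cast; ring), e1 n k n (n+k+1-1) rfl (by push_cast; ring)]
      have := hR n k
      unfold RtB at this
      push_cast
      linear_combination this
    · obtain ⟨n, hn⟩ := Int.eq_ofNat_of_zero_le (by omega : 0 ≤ -N - 1)
      obtain rfl : N = -n - 1 := by omega
      obtain ⟨k, hk⟩ := Int.eq_ofNat_of_zero_le (by rw [abs_of_neg h] at a; omega : 0 ≤ M - n - 2)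
      obtain rfl : M = n + k + 2 := by omega
      rw [e2 (n+1) (k+1) (-n-1) (n+k+2) (by push_cast; ring) (by push_cast; ring), e2 n (k+2) (-n-1+1) (n+k+2) (by push_cast; ring) (by push_cast; ring), e2 (n+1) (k+2) (-n-1) (n+k+2+1) (by push_cast; ring) (by push_cast; ring), e2 (n+1) k (-n-1) (n+k+2-1) (by push_cast; ring) (by push_cast; ring)]
      have := hL n k
      unfold RtB at this
      push_cast
      linear_combination this
  · intro N M a
    unfold inVint at a
    rcases le_or_gt 0 N with h | h
    · obtain ⟨n, rfl⟩ := Int.eq_ofNat_of_zero_le h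
      obtain ⟨k, hk⟩ := Int.eq_ofNat_of_zero_le (by rw [abs_of_nonneg h] at a; omega : 0 ≤ M - n - 1)
      obtain rfl : M = n + k + 1 := by omega
      rw [e1 n (k+1) n (n+k+1) rfl (by push_cast; ring), e1 (n+1) k (n+1) (n+k+1) (by push_cast; ring) (by push_cast; ring), e1 n k n (n+k+1-1) rfl (by push_cast; ring)]
      exact hA n k
    · obtain ⟨n, hn⟩ := Int.eq_ofNat_of_zero_le (by omega : 0 ≤ -N - 1)
      obtain rfl : N = -n - 1 := by omega
      obtain ⟨k, hk⟩ := Int.eq_ofNat_of_zero_le (by rw [abs_of_neg h] at a; omega : 0 ≤ M - n - 2)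
      obtain rfl : M = n + k + 2 := by omega
      rw [e2 (n+1) (k+1) (-n-1) (n+k+2) (by push_cast; ring) (by push_cast; ring), e2 n (k+2) (-n-1+1) (n+k+2) (by push_cast; ring) (by push_cast; ring), e2 (n+1) k (-n-1) (n+k+2-1) (by push_cast; ring) (by push_cast; ring)]
      exact hA' n k

lemma invD {γ : ℝ} (h0 : 0 < γ) (h2 : γ < 2) {R : ℤ → ℤ → ℝ} (hp : ∀ N M, 0 < R N M)
    (h : IsRadiiSolution (2-γ) R) : IsRadiiSolution γ (fun N M => (R N M)⁻¹) := by
  obtain ⟨hS, hr, hR⟩ := h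
  refine ⟨?_, ?_, ?_⟩
  · intro N M a1 a2 a3 a4
    have := hS N M a1 a2 a3 a4
    unfold SquareEq at this ⊢
    beta_reduce
    have p1 := hp N M
    have p2 := hp (N+1) M
    have p3 := hp N (M+1)
    have p4 := hp (N+1) (M+1)
    generalize R N M = a at *
    generalize R (N+1) M = b at *
    generalize R N (M+1) = c at *
    generalize R (N+1) (M+1) = d at *
    field_simp
    linear_combination -this
  · intro N
    obtain ⟨a1, a2⟩ := hr N
    have hn : (0:ℝ) ≤ N := N.cast_nonneg
    have q : ((2 * (N : ℝ) + (2-γ)) / (2 * ((N : ℝ) + 1) - (2-γ)))⁻¹ = (2 * (N : ℝ) + γ) / (2 * ((N : ℝ) + 1) - γ) := by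
      rw [inv_div]; congr 1 <;> ring
    constructor
    · show (R _ _)⁻¹ = _ * (R _ _)⁻¹
      rw [a1, mul_inv, q]
    · show (R _ _)⁻¹ = _ * (R _ _)⁻¹
      rw [a2, mul_inv, q]
  · intro N M a
    have := hR N M a
    unfold RiEq at this ⊢
    beta_reduce
    have p1 := hp N M
    have p2 := hp (N+1) M
    have p3 := hp N (M+1)
    have p4 := hp N (M-1)
    generalize R N M = a at *
    generalize R (N+1) M = b at *
    generalize R N (M+1) = c at *
    generalize R N (M-1) = d at *
    have e : ((N:ℝ)+M) * (a⁻¹^2 - b⁻¹*d⁻¹)*(c⁻¹+b⁻¹) + ((M:ℝ)-N)*(a⁻¹^2-c⁻¹*b⁻¹)*(b⁻¹+d⁻¹) =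
      -(((N:ℝ)+M) * (a^2 - b*d)*(c+b) + ((M:ℝ)-N)*(a^2-c*b)*(b+d)) / (a^2*b^2*c*d) := by
      field_simp
      ring
    rw [e, this]; simp

/-- existence of `a > 0` and a solution of the radii system with
`R(0) = 1`, `R(i) = a·tan(γπ/4)` satisfying the positivity and sign conditions on `V_int`. -/
theorem stmt14 (γ : ℝ) (hγ0 : 0 < γ) (hγ2 : γ < 2) (hγ1 : γ ≠ 1) :
    ∃ (a : ℝ) (R : ℤ → ℤ → ℝ), 0 < a ∧ IsRadiiSolution γ R ∧
      R 0 0 = 1 ∧ R 0 1 = a * Real.tan (γ * Real.pi / 4) ∧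
      ∀ N M : ℤ, inVint N M → 0 < R N M ∧
        0 ≤ (γ - 1) * (R N M ^ 2 - R N (M - 1) * R (N + 1) M) := by
  have main : ∃ R : ℤ → ℤ → ℝ, R 0 0 = 1 ∧ (∀ N M, 0 < R N M) ∧ IsRadiiSolution γ R ∧
      ∀ N M, inVint N M → 0 ≤ (γ - 1) * (R N M ^ 2 - R N (M - 1) * R (N + 1) M) := by
    rcases lt_or_gt_of_ne hγ1 with h | h
    · obtain ⟨R, a1, a2, a3, a4⟩ := mainD hγ0 h
      refine ⟨R, a1, a2, a3, fun N M hm => ?_⟩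
      have := a4 N M hm
      exact mul_nonneg_of_nonpos_of_nonpos (by linarith) (by linarith)
    · obtain ⟨R, a1, a2, a3, a4⟩ := mainD (γ := 2 - γ) (by linarith) (by linarith)
      refine ⟨fun N M => (R N M)⁻¹, by simp [a1], fun N M => inv_pos.2 (a2 N M), invD hγ0 hγ2 a2 a3, fun N M hm => ?_⟩
      have := a4 N M hm
      have p := a2 N M
      have : (R N (M-1))⁻¹ * (R (N+1) M)⁻¹ ≤ (R N M)⁻¹^2 := by
        rw [← mul_inv, inv_pow]
        exact inv_anti₀ (by positivity) this
      exact mul_nonneg (by linarith) (by linarith)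
  obtain ⟨R, a1, a2, a3, a4⟩ := main
  have ht : 0 < Real.tan (γ * Real.pi / 4) := by
    have := Real.pi_pos
    apply Real.tan_pos_of_pos_of_lt_pi_div_two
    · positivity
    · nlinarith
  refine ⟨R 0 1 / Real.tan (γ * Real.pi / 4), R, div_pos (a2 _ _) ht, a3, a1, ?_, fun N M hm => ⟨a2 N M, a4 N M hm⟩⟩
  field_simp
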